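/- arXiv:0910.3975 — 2 statements merged into one kernel-verified Lean document; each statement's English description precedes it below -/
import Mathlib

section
/- The tandem-queue recursion is pathwise monotone: fix any link-state sequence z : ℕ × {1,…,ℓ} → Bool and two initial queue vectors a(0), b(0) : {1,…,ℓ} → ℕ evolving by the same recursion a_i(t+1) = a_i(t) − 1{z_{t,i} = true and a_i(t) > 0} + 1{z_{t,i−1} = true and a_{i−1}(t) > 0} (the last term absent for i = 1), and similarly for b. If a_i(0) ≤ b_i(0) for all i, then a_i(t) ≤ b_i(t) for all i and all t ≥ 0. -/
open MeasureTheory ProbabilityTheory Finset Filter ENNReal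

noncomputable section

/-- One synchronous step of the tandem queue: station `i` serves one customer iff
`z i = true` and its queue is nonempty; the served customer joins station `i+1`
(station `0` has no external arrivals). -/
def tandemStep (ℓ : ℕ) (z : Fin ℓ → Bool) (q : Fin ℓ → ℕ) : Fin ℓ → ℕ := fun i =>
  q i - (if z i = true ∧ 0 < q i then 1 else 0) +
    (if 0 < (i : ℕ) ∧ z ⟨(i : ℕ) - 1, Nat.lt_of_le_of_lt (Nat.sub_le _ 1) i.isLt⟩ = true ∧
        0 < q ⟨(i : ℕ) - 1, Nat.lt_of_le_of_lt (Nat.sub_le _ 1) i.isLt⟩ then 1 else 0)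

/-- Tandem queue evolution from the initial queue vector `q0`, driven by the link states `z`
(`z (t, i) = true` means station/link `i` succeeds at time step `t`). -/
def tandem (ℓ : ℕ) (z : ℕ × Fin ℓ → Bool) (q0 : Fin ℓ → ℕ) : ℕ → Fin ℓ → ℕ
  | 0 => q0
  | t + 1 => tandemStep ℓ (fun i => z (t, i)) (tandem ℓ z q0 t)

/-- Queues of the line network with batch size `n`: `lineQueue ℓ n z t i` is the number of
innovative packets at node `N^(i+1)` at time `t` (0-based link/node indexing, so queue `i`
is served by link `i` and node `N^(1)`, the source, is queue `0`). -/
def lineQueue (ℓ n : ℕ) (z : ℕ × Fin ℓ → Bool) : ℕ → Fin ℓ → ℕ :=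
  tandem ℓ z (fun i => if (i : ℕ) = 0 then n else 0)

/-- `R_t = n - ∑_i q_i(t)`: the number of packets received at the destination by time `t`. -/
def lineReceived (ℓ n : ℕ) (z : ℕ × Fin ℓ → Bool) (t : ℕ) : ℕ :=
  n - ∑ i, lineQueue ℓ n z t i

/-- `T_n = inf {t | R_t = n}`: the total transmission time (`∞` if the batch never
completes), as an extended nonnegative real. -/
def lineTime (ℓ n : ℕ) (z : ℕ × Fin ℓ → Bool) : ℝ≥0∞ :=
  ⨅ (t : ℕ) (_ : lineReceived ℓ n z t = n), (t : ℝ≥0∞)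

/-- `S_j`: the time step at which the `j`-th success of the first link occurs
(junk value if there is no such time step). -/
def sTime (ℓ : ℕ) (hℓ : 0 < ℓ) (z : ℕ × Fin ℓ → Bool) (j : ℕ) : ℕ :=
  sInf {t : ℕ | z (t, ⟨0, hℓ⟩) = true ∧
    ((Finset.range t).filter fun s => z (s, ⟨0, hℓ⟩) = true).card = j - 1}

theorem tandemStep_monotone (ℓ : ℕ) (z : Fin ℓ → Bool) : Monotone (tandemStep ℓ z) := by
  intro a b hab i
  refine Nat.add_le_add ?_ ?_
  · have hi := hab i
    split_ifs <;> grind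
  · have hpred := hab ⟨(i : ℕ) - 1, Nat.lt_of_le_of_lt (Nat.sub_le _ 1) i.isLt⟩
    split_ifs <;> grind

/-- The tandem-queue recursion is pathwise monotone: if two initial queue vectors satisfy
`a0 ≤ b0` componentwise and both evolve under the same link-state sequence `z`, then the
componentwise order is preserved for all times. -/
theorem tandem_pathwise_monotone {ℓ : ℕ} (hℓ : 0 < ℓ) (z : ℕ × Fin ℓ → Bool)
    (a0 b0 : Fin ℓ → ℕ) (h0 : ∀ i, a0 i ≤ b0 i) :
    ∀ (t : ℕ) (i : Fin ℓ), tandem ℓ z a0 t i ≤ tandem ℓ z b0 t i := by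
  intro t
  induction t with
  | zero => exact h0
  | succ t ih => exact tandemStep_monotone ℓ (fun i => z (t, i)) ih
end
end

section
/- The received-packet count is 1-Lipschitz in the link states: fix ℓ ≥ 1, batch size n ≥ 1, and two link-state sequences z, z' : ℕ × {1,…,ℓ} → Bool that differ in exactly one coordinate (t₀, i₀). Let q and q' be the queue processes generated from z and z' respectively by the recursion with q_1(0) = q'_1(0) = n and all other queues initially 0, and let R_t = n − Σ_{i=1}^ℓ q_i(t), R'_t = n − Σ_{i=1}^ℓ q'_i(t). Then |R_t − R'_t| ≤ 1 for every t ≥ 0. -/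
open MeasureTheory ProbabilityTheory Finset Filter ENNReal

noncomputable section

/-- Number of customers in the first `k` stations. -/
def queuePrefix {ℓ : ℕ} (q : Fin ℓ → ℕ) (k : ℕ) : ℕ :=
  ∑ j ∈ Finset.range k, if h : j < ℓ then q ⟨j, h⟩ else 0

theorem queuePrefix_zero {ℓ : ℕ} (q : Fin ℓ → ℕ) : queuePrefix q 0 = 0 :=
  Finset.sum_range_zero _

theorem queuePrefix_succ {ℓ : ℕ} (q : Fin ℓ → ℕ) {k : ℕ} (hk : k < ℓ) :
    queuePrefix q (k + 1) = queuePrefix q k + q ⟨k, hk⟩ := by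
  simp [queuePrefix, Finset.sum_range_succ, hk]

theorem queuePrefix_self {ℓ : ℕ} (q : Fin ℓ → ℕ) : queuePrefix q ℓ = ∑ i, q i :=
  (Finset.sum_fin_eq_sum_range q).symm

/-- A step removes from the first `k + 1` stations exactly the customer served at station `k`. -/
theorem queuePrefix_tandemStep_add {ℓ : ℕ} (z : Fin ℓ → Bool) (q : Fin ℓ → ℕ) {k : ℕ}
    (hk : k < ℓ) :
    queuePrefix (tandemStep ℓ z q) (k + 1) +
      (if z ⟨k, hk⟩ = true ∧ 0 < q ⟨k, hk⟩ then 1 else 0) = queuePrefix q (k + 1) := by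
  induction k with
  | zero =>
    rw [queuePrefix_succ _ hk, queuePrefix_succ _ hk, queuePrefix_zero, queuePrefix_zero]
    simp only [tandemStep, lt_irrefl, false_and, if_false]
    split_ifs <;> omega
  | succ k ih =>
    have h := ih (by omega)
    rw [queuePrefix_succ _ hk, queuePrefix_succ q hk, ← h]
    simp only [tandemStep, Nat.add_sub_cancel, Nat.succ_pos, true_and]
    split_ifs <;> omega

/-- In terms of prefix sums, a step is a maximum of translates of coordinates. -/
theorem queuePrefix_tandemStep {ℓ : ℕ} (z : Fin ℓ → Bool) (q : Fin ℓ → ℕ) {k : ℕ}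
    (hk : k < ℓ) :
    (queuePrefix (tandemStep ℓ z q) (k + 1) : ℤ) =
      if z ⟨k, hk⟩ = true then max ((queuePrefix q (k + 1) : ℤ) - 1) (queuePrefix q k)
      else queuePrefix q (k + 1) := by
  have h := queuePrefix_tandemStep_add z q hk
  have hs := queuePrefix_succ q hk
  by_cases hz : z ⟨k, hk⟩ = true
  · simp only [hz, true_and, if_true] at h ⊢
    split_ifs at h <;> omega
  · simp only [hz, Bool.false_eq_true, false_and, if_false] at h ⊢
    omega

theorem tandem_congr {ℓ : ℕ} {z z' : ℕ × Fin ℓ → Bool} (q0 : Fin ℓ → ℕ) {t : ℕ}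
    (h : ∀ s < t, ∀ i, z (s, i) = z' (s, i)) : tandem ℓ z q0 t = tandem ℓ z' q0 t := by
  induction t with
  | zero => rfl
  | succ t ih =>
    simp only [tandem]
    rw [ih fun s hs => h s (by omega), funext (h t (by omega))]

theorem abs_queuePrefix_tandem_sub_le_one {ℓ : ℕ} {z z' : ℕ × Fin ℓ → Bool} (q0 : Fin ℓ → ℕ)
    (t₀ : ℕ) (h : ∀ t ≠ t₀, ∀ i, z (t, i) = z' (t, i)) (t : ℕ) {k : ℕ} (hk : k ≤ ℓ) :
    |(queuePrefix (tandem ℓ z q0 t) k : ℤ) - queuePrefix (tandem ℓ z' q0 t) k| ≤ 1 := by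
  induction t generalizing k with
  | zero => simp [tandem]
  | succ t ih =>
    cases k with
    | zero => simp [queuePrefix_zero]
    | succ k =>
      simp only [tandem]
      rw [queuePrefix_tandemStep _ _ hk, queuePrefix_tandemStep _ _ hk]
      rcases eq_or_ne t t₀ with rfl | ht
      · rw [tandem_congr q0 fun s hs => h s hs.ne]
        have hs := queuePrefix_succ (tandem ℓ z' q0 t) hk
        rw [abs_le]
        split_ifs <;> omega
      · have h₁ := abs_le.1 (ih hk)
        have h₂ := abs_le.1 (ih (Nat.le_of_succ_le hk))
        rw [h t ht, abs_le]
        split_ifs <;> omega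

/-- The received-packet count is 1-Lipschitz in the link states: if `z` and `z'` differ in
exactly one coordinate `c₀`, then `|R_t - R'_t| ≤ 1` for every `t`. -/
theorem received_one_lipschitz {ℓ : ℕ} (hℓ : 0 < ℓ) (n : ℕ) (hn : 1 ≤ n)
    (z z' : ℕ × Fin ℓ → Bool) (c₀ : ℕ × Fin ℓ)
    (hne : z c₀ ≠ z' c₀) (heq : ∀ c, c ≠ c₀ → z c = z' c) :
    ∀ t : ℕ, |(lineReceived ℓ n z t : ℤ) - (lineReceived ℓ n z' t : ℤ)| ≤ 1 := by
  intro t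
  have h := abs_queuePrefix_tandem_sub_le_one (z := z) (z' := z')
    (fun i : Fin ℓ => if (i : ℕ) = 0 then n else 0) c₀.1
    (fun s hs i => heq (s, i) fun hc => hs (congrArg Prod.fst hc)) t le_rfl
  rw [queuePrefix_self, queuePrefix_self, abs_le] at h
  simp only [lineReceived, lineQueue]
  rw [abs_le]
  omega
end
end
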